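/- A compactum X is hereditarily indecomposable if and only if: for any map f: X → G to a graph G, any set M ⊆ G × (0,1) which separates G × {0} from G × {1} in G × [0,1], any open set U ⊆ G × [0,1] with M ⊆ U, and any ε > 0, there exists a map h: X → U such that sup_{x∈X} d(f(x), π₁(h(x))) < ε, where π₁: G × [0,1] → G is the first coordinate projection. -/

import Mathlib

open Set Topology

/-- A subset of a space is *regular* if it is closed and has finitely many connected
components, each of which is non-degenerate. -/
def IsRegularSet {G : Type*} [TopologicalSpace G] (A : Set G) : Prop :=
  IsClosed A ∧ {C : Set G | ∃ x ∈ A, C = connectedComponentIn A x}.Finite ∧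
    ∀ x ∈ A, (connectedComponentIn A x).Nontrivial

/-- A point of a graph is *ordinary* (neither a branch point nor an endpoint) if it has an
open neighborhood homeomorphic to an open interval. -/
def IsOrdinaryPoint {G : Type*} [TopologicalSpace G] (x : G) : Prop :=
  ∃ U : Set G, IsOpen U ∧ x ∈ U ∧ Nonempty (U ≃ₜ Set.Ioo (0 : ℝ) 1)

/-- A topological space is a *graph* if it is a finite union of arcs which intersect
at most in endpoints. -/
def IsGraphSpace (G : Type*) [TopologicalSpace G] : Prop :=
  ∃ (n : ℕ) (f : Fin n → unitInterval → G),
    (∀ i, Continuous (f i) ∧ Function.Injective (f i)) ∧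
    (⋃ i, Set.range (f i)) = Set.univ ∧
    ∀ i j, i ≠ j →
      Set.range (f i) ∩ Set.range (f j) ⊆ ({f i 0, f i 1} : Set G) ∩ {f j 0, f j 1}

/-- A subset of a space is a *graph* if it is a finite union of arcs which intersect
at most in endpoints. -/
def IsGraphSet {E : Type*} [TopologicalSpace E] (G : Set E) : Prop :=
  ∃ (n : ℕ) (f : Fin n → unitInterval → E),
    (∀ i, Continuous (f i) ∧ Function.Injective (f i)) ∧
    G = ⋃ i, Set.range (f i) ∧
    ∀ i j, i ≠ j →
      Set.range (f i) ∩ Set.range (f j) ⊆ ({f i 0, f i 1} : Set E) ∩ {f j 0, f j 1}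

/-- `φ` restricted to `A` is a homeomorphism onto `B`. -/
def MapsHomeoOnto {F G : Type*} [TopologicalSpace F] [TopologicalSpace G]
    (φ : F → G) (A : Set F) (B : Set G) : Prop :=
  φ '' A = B ∧ Topology.IsEmbedding (A.restrict φ)

/-- A *simple fold* on `G`, with pieces `F1, F2, F3` of `F` and projection `φ : F → G`,
satisfying properties (F1)-(F5). -/
def IsSimpleFold {F G : Type*} [TopologicalSpace F] [TopologicalSpace G]
    (φ : F → G) (F1 F2 F3 : Set F) : Prop :=
  Continuous φ ∧ F1 ∪ F2 ∪ F3 = Set.univ ∧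
  -- (F1)
  ((φ '' F1).Nonempty ∧ (φ '' F2).Nonempty ∧ (φ '' F3).Nonempty) ∧
  (IsRegularSet (φ '' F1) ∧ IsRegularSet (φ '' F2) ∧ IsRegularSet (φ '' F3)) ∧
  -- (F2)
  (φ '' F1) ∪ (φ '' F3) = Set.univ ∧ (φ '' F2) = (φ '' F1) ∩ (φ '' F3) ∧
  -- (F3)
  closure ((φ '' F1) \ (φ '' F2)) ∩ closure ((φ '' F3) \ (φ '' F2)) = ∅ ∧
  -- (F4)
  (MapsHomeoOnto φ F1 (φ '' F1) ∧ MapsHomeoOnto φ F2 (φ '' F2) ∧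
    MapsHomeoOnto φ F3 (φ '' F3)) ∧
  -- (F5)
  frontier (φ '' F1) = φ '' (F1 ∩ F2) ∧ frontier (φ '' F3) = φ '' (F2 ∩ F3) ∧
  F1 ∩ F3 = ∅

/-- `S` separates `A` from `B` within `Y`: the complement `Y \ S` is the union of two
disjoint sets, relatively open in `Y \ S`, containing `A` and `B` respectively. -/
def SeparatesWithin {E : Type*} [TopologicalSpace E] (Y S A B : Set E) : Prop :=
  ∃ U V : Set E,
    U ∪ V = Y \ S ∧ U ∩ V = ∅ ∧ A ⊆ U ∧ B ⊆ V ∧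
    (∃ U', IsOpen U' ∧ U = (Y \ S) ∩ U') ∧ (∃ V', IsOpen V' ∧ V = (Y \ S) ∩ V')

/-- `A` has *consistent complement relative to* `B`: for each component `C` of the
complement of `A`, either `∂C ⊆ B` or `∂C ∩ B = ∅`. -/
def ConsistentComplement {G : Type*} [TopologicalSpace G] (A B : Set G) : Prop :=
  ∀ x ∉ A, frontier (connectedComponentIn Aᶜ x) ⊆ B ∨
    frontier (connectedComponentIn Aᶜ x) ∩ B = ∅

/-- The *`A` side of `B`*, `σ_B(A)`: the closure of the union of all components of
`G \ B` meeting `A`. -/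
def sideOf {G : Type*} [TopologicalSpace G] (B A : Set G) : Set G :=
  closure (⋃ x ∈ {x : G | x ∉ B ∧ (connectedComponentIn Bᶜ x ∩ A).Nonempty},
    connectedComponentIn Bᶜ x)

/-- A subset of `G × [0,1]` is *straight* if it is closed, the projection is injective on
it, and its projection is regular. -/
def IsStraight {G : Type*} [TopologicalSpace G] (S : Set (G × unitInterval)) : Prop :=
  IsClosed S ∧ Set.InjOn Prod.fst S ∧ IsRegularSet (Prod.fst '' S)

/-- The *end set* of a straight set. -/
def endSet {G : Type*} [TopologicalSpace G] (S : Set (G × unitInterval)) :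
    Set (G × unitInterval) :=
  S ∩ Prod.fst ⁻¹' (frontier (Prod.fst '' S))

/-- A *stairwell structure* of height `k` for `S ⊆ G × [0,1]`, given by the pieces
`Sp 1, …, Sp k` with end set decompositions `E(Sp i) = α i ∪ β i`. -/
def IsStairwell {G : Type*} [TopologicalSpace G]
    (Sp α β : ℕ → Set (G × unitInterval)) (k : ℕ) (S : Set (G × unitInterval)) : Prop :=
  1 ≤ k ∧
  -- (S1)
  (∀ i ∈ Set.Icc 1 k, (Sp i).Nonempty ∧ IsStraight (Sp i)) ∧
  S = ⋃ i ∈ Set.Icc 1 k, Sp i ∧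
  -- (S2)
  (∀ i ∈ Set.Icc 1 k, endSet (Sp i) = α i ∪ β i ∧ α i ∩ β i = ∅ ∧
    (α i).Finite ∧ (β i).Finite) ∧
  α 1 = ∅ ∧ β k = ∅ ∧ (∀ i, 1 ≤ i → i < k → β i = α (i + 1)) ∧
  -- (S3)
  (∀ i, 1 ≤ i → i < k → ∃ V : Set G, IsOpen V ∧ Prod.fst '' β i ⊆ V ∧
    Prod.fst '' Sp i ∩ V = Prod.fst '' Sp (i + 1) ∩ V) ∧
  -- (S4)
  (∀ i ∈ Set.Icc 1 k, ConsistentComplement (Prod.fst '' Sp i) (Prod.fst '' α i) ∧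
    ConsistentComplement (Prod.fst '' Sp i) (Prod.fst '' β i)) ∧
  -- (S5)
  (∀ i ∈ Set.Icc 2 k, ∀ p ∈ α i, IsOrdinaryPoint p.1) ∧
  (∀ i j, 2 ≤ i → i < j → j ≤ k → Prod.fst '' α i ∩ Prod.fst '' α j = ∅)

/-- A *broken stairwell structure* of height `k` with a pit at level `i0`. -/
def IsBrokenStairwell {G : Type*} [TopologicalSpace G]
    (Sp α β : ℕ → Set (G × unitInterval)) (γ P1 P2 : Set (G × unitInterval))
    (k i0 : ℕ) (S : Set (G × unitInterval)) : Prop :=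
  1 ≤ k ∧ 1 ≤ i0 ∧ i0 ≤ k ∧
  -- (S1')
  (∀ i ∈ Set.Icc 1 k, (Sp i).Nonempty ∧ IsStraight (Sp i)) ∧
  P1.Nonempty ∧ IsStraight P1 ∧ P2.Nonempty ∧ IsStraight P2 ∧
  S = (⋃ i ∈ Set.Icc 1 k, Sp i) ∪ P1 ∪ P2 ∧
  -- (S2')
  (∀ i ∈ Set.Icc 1 k, i ≠ i0 → endSet (Sp i) = α i ∪ β i) ∧
  endSet (Sp i0) = α i0 ∪ β i0 ∪ γ ∧
  (∀ i ∈ Set.Icc 1 k, α i ∩ β i = ∅ ∧ (α i).Finite ∧ (β i).Finite) ∧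
  γ.Finite ∧ α i0 ∩ γ = ∅ ∧ β i0 ∩ γ = ∅ ∧
  α 1 = ∅ ∧ β k = ∅ ∧ (∀ i, 1 ≤ i → i < k → β i = α (i + 1)) ∧
  endSet P2 = endSet P1 ∪ γ ∧ endSet P1 ∩ γ = ∅ ∧
  -- (S3')
  (∀ i, 1 ≤ i → i < k → ∃ V : Set G, IsOpen V ∧ Prod.fst '' β i ⊆ V ∧
    Prod.fst '' Sp i ∩ V = Prod.fst '' Sp (i + 1) ∩ V) ∧
  (∃ V : Set G, IsOpen V ∧ Prod.fst '' endSet P1 ⊆ V ∧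
    Prod.fst '' P1 ∩ V = Prod.fst '' P2 ∩ V) ∧
  (∃ W : Set G, IsOpen W ∧ Prod.fst '' γ ⊆ W ∧
    Prod.fst '' P2 ∩ W = Prod.fst '' Sp i0 ∩ W) ∧
  -- (S4')
  (∀ i ∈ Set.Icc 1 k, ConsistentComplement (Prod.fst '' Sp i) (Prod.fst '' α i) ∧
    ConsistentComplement (Prod.fst '' Sp i) (Prod.fst '' β i)) ∧
  ConsistentComplement (Prod.fst '' Sp i0) (Prod.fst '' γ) ∧
  ConsistentComplement (Prod.fst '' P2) (Prod.fst '' endSet P1) ∧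
  ConsistentComplement (Prod.fst '' P2) (Prod.fst '' γ) ∧
  -- (S5')
  (∀ i ∈ Set.Icc 2 k, ∀ p ∈ α i, IsOrdinaryPoint p.1) ∧
  (∀ p ∈ endSet P1, IsOrdinaryPoint p.1) ∧ (∀ p ∈ γ, IsOrdinaryPoint p.1) ∧
  (∀ i j, 2 ≤ i → i < j → j ≤ k → Prod.fst '' α i ∩ Prod.fst '' α j = ∅) ∧
  (∀ i ∈ Set.Icc 2 k, Prod.fst '' α i ∩ Prod.fst '' endSet P1 = ∅ ∧
    Prod.fst '' α i ∩ Prod.fst '' γ = ∅) ∧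
  Prod.fst '' endSet P1 ∩ Prod.fst '' γ = ∅ ∧
  -- (S6')
  Prod.fst '' α i0 ∩ Prod.fst '' (P1 ∪ P2) = ∅

/-- A compactum is *hereditarily indecomposable* if every non-degenerate subcontinuum is
indecomposable, i.e. is not the union of two proper subcontinua. -/
def HereditarilyIndecomposable (X : Type*) [TopologicalSpace X] : Prop :=
  ∀ K : Set X, IsCompact K → IsConnected K → K.Nontrivial →
    ¬ ∃ A B : Set X, IsCompact A ∧ IsConnected A ∧ IsCompact B ∧ IsConnected B ∧
      A ∪ B = K ∧ A ≠ K ∧ B ≠ K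

/-- A continuum is *arc-like* if for every `ε > 0` it admits an `ε`-map onto `[0,1]`. -/
def ArcLike (X : Type*) [MetricSpace X] : Prop :=
  ∀ ε > (0 : ℝ), ∃ f : X → unitInterval, Continuous f ∧ Function.Surjective f ∧
    ∀ y, Metric.diam (f ⁻¹' {y}) < ε

/-- A continuum has *span zero* if every subcontinuum `Z ⊆ X × X` with
`π₁(Z) ⊆ π₂(Z)` meets the diagonal. -/
def SpanZero (X : Type*) [TopologicalSpace X] : Prop :=
  ∀ Z : Set (X × X), IsCompact Z → IsConnected Z →
    Prod.fst '' Z ⊆ Prod.snd '' Z → ∃ x, (x, x) ∈ Z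

theorem HereditarilyIndecomposable.subset_or_subset {X : Type*} [TopologicalSpace X]
    (hX : HereditarilyIndecomposable X) {A B : Set X} (hA : IsCompact A) (hA' : IsConnected A)
    (hB : IsCompact B) (hB' : IsConnected B) (hAB : (A ∩ B).Nonempty) : A ⊆ B ∨ B ⊆ A := by
  by_contra! h
  have hU : IsConnected (A ∪ B) := IsConnected.union hAB hA' hB'
  refine hX (A ∪ B) (hA.union hB) hU ?_ ⟨A, B, hA, hA', hB, hB', rfl, ?_, ?_⟩
  · obtain ⟨a, ha, hab⟩ := not_subset.1 h.1
    obtain ⟨b, hb, hba⟩ := not_subset.1 h.2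
    exact ⟨a, Or.inl ha, b, Or.inr hb, fun e => hba (e ▸ ha)⟩
  · intro e; exact h.2 (e ▸ subset_union_right)
  · intro e; exact h.1 (e ▸ subset_union_left)

theorem IsClosed.isClosed_connectedComponentIn {Y : Type*} [TopologicalSpace Y] {K : Set Y}
    (hK : IsClosed K) (p : Y) : IsClosed (connectedComponentIn K p) := by
  by_cases hp : p ∈ K
  · rw [connectedComponentIn_eq_image hp]
    exact hK.isClosedEmbedding_subtypeVal.isClosedMap _ isClosed_connectedComponent
  · rw [connectedComponentIn_eq_empty hp]; exact isClosed_empty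

theorem IsCompact.isCompact_connectedComponentIn {Y : Type*} [TopologicalSpace Y]
    [T2Space Y] {K : Set Y}
    (hK : IsCompact K) (p : Y) : IsCompact (connectedComponentIn K p) :=
  hK.of_isClosed_subset (hK.isClosed.isClosed_connectedComponentIn p)
    (connectedComponentIn_subset K p)

/-- In a compact set, a component missing a closed set can be separated from it. -/
theorem IsCompact.exists_split_of_disjoint_connectedComponentIn {Y : Type*} [TopologicalSpace Y]
    [T2Space Y] {K S : Set Y} (hK : IsCompact K) (hS : IsClosed S) {p : Y} (hp : p ∈ K)
    (h : Disjoint (connectedComponentIn K p) S) :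
    ∃ F F' : Set Y, IsCompact F ∧ IsCompact F' ∧ F ∪ F' = K ∧ Disjoint F F' ∧ p ∈ F ∧
      Disjoint F S := by
  have : CompactSpace K := isCompact_iff_compactSpace.1 hK
  rw [connectedComponentIn_eq_image hp] at h
  set S' : Set K := Subtype.val ⁻¹' S
  have hS' : IsClosed S' := hS.preimage continuous_subtype_val
  have key : ∃ s : Set K, IsClopen s ∧ (⟨p, hp⟩ : K) ∈ s ∧ Disjoint s S' := by
    by_contra! hcon
    have : Nonempty {s : Set K // IsClopen s ∧ (⟨p, hp⟩ : K) ∈ s} :=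
      ⟨⟨univ, isClopen_univ, trivial⟩⟩
    have := IsCompact.nonempty_iInter_of_directed_nonempty_isCompact_isClosed
      (fun s : {s : Set K // IsClopen s ∧ (⟨p, hp⟩ : K) ∈ s} => s.1 ∩ S') ?_ ?_ ?_ ?_
    · obtain ⟨y, hy⟩ := this
      have hy0 := mem_iInter.1 hy
      refine disjoint_left.1 h ⟨y, ?_, rfl⟩ (hy0 ⟨univ, isClopen_univ, trivial⟩).2
      rw [connectedComponent_eq_iInter_isClopen]
      exact mem_iInter.2 fun s => (hy0 s).1
    · intro s t
      exact ⟨⟨s.1 ∩ t.1, s.2.1.inter t.2.1, s.2.2, t.2.2⟩,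
        inter_subset_inter_left _ inter_subset_left, inter_subset_inter_left _ inter_subset_right⟩
    · intro s
      exact not_disjoint_iff_nonempty_inter.1 (hcon s.1 s.2.1 s.2.2)
    · intro s
      exact (s.2.1.isClosed.inter hS').isCompact
    · intro s
      exact s.2.1.isClosed.inter hS'
  obtain ⟨s, hs, hps, hsS⟩ := key
  refine ⟨Subtype.val '' s, Subtype.val '' sᶜ, hs.isClosed.isCompact.image continuous_subtype_val,
    hs.compl.isClosed.isCompact.image continuous_subtype_val, ?_, ?_, ⟨_, hps, rfl⟩, ?_⟩
  · rw [← image_union, union_compl_self, image_univ, Subtype.range_coe]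
  · exact (disjoint_image_iff Subtype.val_injective).2 disjoint_compl_right
  · rw [disjoint_left]
    rintro _ ⟨y, hy, rfl⟩ hyS
    exact disjoint_left.1 hsS hy hyS

/-- Boundary bumping. -/
theorem IsConnected.connectedComponentIn_diff_inter_closure_nonempty {Y : Type*}
    [TopologicalSpace Y] [T2Space Y] {C O : Set Y} (hC : IsCompact C) (hC' : IsConnected C)
    (hO : IsOpen O) {p : Y} (hp : p ∈ C \ O) (hCO : (C ∩ O).Nonempty) :
    (connectedComponentIn (C \ O) p ∩ closure O).Nonempty := by
  by_contra hcon
  obtain ⟨F, F', hF, hF', hu, hd, hpF, hFS⟩ :=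
    (hC.diff hO).exists_split_of_disjoint_connectedComponentIn isClosed_closure hp
      (disjoint_iff_inter_eq_empty.2 (not_nonempty_iff_eq_empty.1 hcon))
  have hcl := isPreconnected_closed_iff.1 hC'.isPreconnected F (F' ∪ (C ∩ closure O)) hF.isClosed
    (hF'.isClosed.union (hC.isClosed.inter isClosed_closure)) ?_ ⟨p, hp.1, hpF⟩ ?_
  · obtain ⟨x, hx, hxF, hx' | hx'⟩ := hcl
    · exact disjoint_left.1 hd hxF hx'
    · exact disjoint_left.1 hFS hxF hx'.2
  · intro x hx
    by_cases hxO : x ∈ O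
    · exact Or.inr (Or.inr ⟨hx, subset_closure hxO⟩)
    · have : x ∈ F ∪ F' := hu ▸ ⟨hx, hxO⟩
      rcases this with h | h
      · exact Or.inl h
      · exact Or.inr (Or.inl h)
  · obtain ⟨x, hx, hxO⟩ := hCO
    exact ⟨x, hx, Or.inr ⟨hx, subset_closure hxO⟩⟩

/-- Maps onto hereditarily indecomposable continua are confluent. -/
theorem HereditarilyIndecomposable.image_connectedComponentIn {X Y : Type*} [TopologicalSpace X]
    [T2Space X] [TopologicalSpace Y] [T4Space Y] (hX : HereditarilyIndecomposable X)
    {π : Y → X} (hπ : Continuous π) {C : Set Y} (hC : IsCompact C) (hC' : IsConnected C)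
    {L : Set X} (hL : IsCompact L) (hL' : IsConnected L) (hLC : L ⊆ π '' C) {q : Y}
    (hq : q ∈ C) (hqL : π q ∈ L) :
    π '' connectedComponentIn (C ∩ π ⁻¹' L) q = L := by
  apply Subset.antisymm
  · rintro _ ⟨z, hz, rfl⟩
    exact (connectedComponentIn_subset _ _ hz).2
  intro y hy
  by_contra hcon
  have hE : IsCompact (C ∩ π ⁻¹' L) := hC.inter_right (hL.isClosed.preimage hπ)
  have hS : IsClosed (π ⁻¹' {y}) := isClosed_singleton.preimage hπ
  obtain ⟨F, F', hF, hF', hu, hd, hqF, hFS⟩ :=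
    hE.exists_split_of_disjoint_connectedComponentIn hS ⟨hq, hqL⟩
      (disjoint_left.2 fun z hz hzy => hcon ⟨z, hz, hzy⟩)
  obtain ⟨O, hO, hFO, hOd⟩ := normal_exists_closure_subset hF.isClosed
    (hF'.isClosed.union hS).isOpen_compl (t := (F' ∪ π ⁻¹' {y})ᶜ) (by
      rw [subset_compl_iff_disjoint_right]
      exact hd.union_right hFS)
  obtain ⟨c, hc, hcy⟩ := hLC hy
  have hcO : c ∈ (closure O)ᶜ := fun h => hOd h (Or.inr hcy)
  have hqO : q ∈ C \ (closure O)ᶜ := ⟨hq, fun h => h (subset_closure (hFO hqF))⟩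
  obtain ⟨z, hz, hzO⟩ := hC'.connectedComponentIn_diff_inter_closure_nonempty hC
    isClosed_closure.isOpen_compl hqO ⟨c, hc, hcO⟩
  set D := connectedComponentIn (C \ (closure O)ᶜ) q with hD
  have hDsub : D ⊆ C ∩ closure O := fun w hw =>
    have := connectedComponentIn_subset _ _ hw
    ⟨this.1, not_not.1 this.2⟩
  have hDc : IsCompact D :=
    (hC.diff isClosed_closure.isOpen_compl).isCompact_connectedComponentIn q
  have hDn : IsConnected D := isConnected_connectedComponentIn_iff.2 hqO
  have hzO' : z ∉ O := by
    have : closure (closure O)ᶜ ⊆ Oᶜ :=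
      closure_minimal (compl_subset_compl.2 subset_closure) hO.isClosed_compl
    exact this hzO
  have hzL : π z ∉ L := by
    intro hzL
    have : z ∈ F ∪ F' := hu ▸ ⟨(hDsub hz).1, hzL⟩
    rcases this with h | h
    · exact hzO' (hFO h)
    · exact hOd (hDsub hz).2 (Or.inl h)
  rcases hX.subset_or_subset (hDc.image hπ) (hDn.image π hπ.continuousOn) hL hL'
    ⟨π q, ⟨q, mem_connectedComponentIn hqO, rfl⟩, hqL⟩ with h | h
  · exact hzL (h ⟨z, hz, rfl⟩)
  · obtain ⟨w, hw, hwy⟩ := h hy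
    exact hOd (hDsub hw).2 (Or.inr hwy)

theorem IsPreconnected.iInter_of_directed {Y ι : Type*} [TopologicalSpace Y] [T2Space Y]
    [Nonempty ι] {C : ι → Set Y} (hd : Directed (· ⊇ ·) C) (hc : ∀ i, IsCompact (C i))
    (hp : ∀ i, IsPreconnected (C i)) : IsPreconnected (⋂ i, C i) := by
  have hcl : IsClosed (⋂ i, C i) := isClosed_iInter fun i => (hc i).isClosed
  have hcp : IsCompact (⋂ i, C i) :=
    (hc (Classical.arbitrary ι)).of_isClosed_subset hcl (iInter_subset _ _)
  rw [isPreconnected_iff_subset_of_fully_disjoint_closed hcl]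
  intro u v hu hv huv hduv
  obtain ⟨U, V, hU, hV, huU, hvV, hUV⟩ := SeparatedNhds.of_isCompact_isCompact
    (hcp.inter_right hu) (hcp.inter_right hv) (hduv.mono inter_subset_right inter_subset_right)
  obtain ⟨i, hi⟩ := exists_subset_nhds_of_isCompact' hd hc (fun i => (hc i).isClosed)
    (U := U ∪ V) fun x hx => (hU.union hV).mem_nhds ((huv hx).imp
      (fun h => huU ⟨hx, h⟩) fun h => hvV ⟨hx, h⟩)
  rcases (isPreconnected_iff_subset_of_disjoint.1 (hp i)) U V hU hV hi
    (by rw [hUV.inter_eq, inter_empty]) with h | h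
  · left
    intro x hx
    exact (huv hx).resolve_right fun hxv =>
      disjoint_left.1 hUV (h (mem_iInter.1 hx i)) (hvV ⟨hx, hxv⟩)
  · right
    intro x hx
    exact (huv hx).resolve_left fun hxu =>
      disjoint_left.1 hUV (huU ⟨hx, hxu⟩) (h (mem_iInter.1 hx i))

theorem image_iInter_of_directed_of_isCompact {X Y ι : Type*} [TopologicalSpace Y] [T2Space Y]
    [TopologicalSpace X] [T1Space X] [Nonempty ι] {π : Y → X} (hπ : Continuous π)
    {C : ι → Set Y} (hd : Directed (· ⊇ ·) C) (hc : ∀ i, IsCompact (C i)) :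
    π '' (⋂ i, C i) = ⋂ i, π '' C i := by
  refine (image_iInter_subset _ _).antisymm fun x hx => ?_
  obtain ⟨y, hy⟩ := IsCompact.nonempty_iInter_of_directed_nonempty_isCompact_isClosed
    (fun i => C i ∩ π ⁻¹' {x})
    (fun i j => by
      obtain ⟨k, hki, hkj⟩ := hd i j
      exact ⟨k, inter_subset_inter_left _ hki, inter_subset_inter_left _ hkj⟩)
    (fun i => by
      obtain ⟨y, hy, hyx⟩ := mem_iInter.1 hx i
      exact ⟨y, hy, hyx⟩)
    (fun i => (hc i).inter_right (isClosed_singleton.preimage hπ))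
    (fun i => (hc i).isClosed.inter (isClosed_singleton.preimage hπ))
  exact ⟨y, mem_iInter.2 fun i => (mem_iInter.1 hy i).1,
    (mem_iInter.1 hy (Classical.arbitrary ι)).2⟩

/-- Some point of `C` lies strictly below a point of `C'` in the same fiber. -/
def FiberLT {X : Type*} (C C' : Set (X × unitInterval)) : Prop :=
  ∃ x s s', s < s' ∧ (x, s) ∈ C ∧ (x, s') ∈ C'

theorem isClosed_setOf_fiber_le {X : Type*} [TopologicalSpace X] {C C' : Set (X × unitInterval)}
    (hC : IsClosed C) (hC' : IsClosed C') :
    IsClosed {p : X × unitInterval × unitInterval |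
      (p.1, p.2.1) ∈ C ∧ (p.1, p.2.2) ∈ C' ∧ p.2.1 ≤ p.2.2} :=
  (hC.preimage (by fun_prop)).inter ((hC'.preimage (by fun_prop)).inter
    (isClosed_le (by fun_prop) (by fun_prop)))

theorem FiberLT.iInter {X ι : Type*} [TopologicalSpace X] [CompactSpace X] [Nonempty ι]
    {C C' : ι → Set (X × unitInterval)}
    (hd : ∀ i j, ∃ k, C k ⊆ C i ∧ C k ⊆ C j ∧ C' k ⊆ C' i ∧ C' k ⊆ C' j)
    (hC : ∀ i, IsClosed (C i)) (hC' : ∀ i, IsClosed (C' i)) (hdisj : ∀ i, Disjoint (C i) (C' i))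
    (h : ∀ i, FiberLT (C i) (C' i)) : FiberLT (⋂ i, C i) (⋂ i, C' i) := by
  obtain ⟨⟨x, s, s'⟩, hp⟩ := IsCompact.nonempty_iInter_of_directed_nonempty_isCompact_isClosed
    (fun i => {p : X × unitInterval × unitInterval |
      (p.1, p.2.1) ∈ C i ∧ (p.1, p.2.2) ∈ C' i ∧ p.2.1 ≤ p.2.2})
    (fun i j => by
      obtain ⟨k, h1, h2, h3, h4⟩ := hd i j
      exact ⟨k, fun p hp => ⟨h1 hp.1, h3 hp.2.1, hp.2.2⟩,
        fun p hp => ⟨h2 hp.1, h4 hp.2.1, hp.2.2⟩⟩)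
    (fun i => by
      obtain ⟨x, s, s', hs, h1, h2⟩ := h i
      exact ⟨(x, s, s'), h1, h2, hs.le⟩)
    (fun i => (isClosed_setOf_fiber_le (hC i) (hC' i)).isCompact)
    (fun i => isClosed_setOf_fiber_le (hC i) (hC' i))
  have hp := mem_iInter.1 hp
  refine ⟨x, s, s', lt_of_le_of_ne (hp (Classical.arbitrary ι)).2.2 ?_,
    mem_iInter.2 fun i => (hp i).1, mem_iInter.2 fun i => (hp i).2.1⟩
  rintro rfl
  exact disjoint_left.1 (hdisj (Classical.arbitrary ι)) (hp _).1 (hp _).2.1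

/-- Disjoint compact sets are uniformly separated along fibers. -/
theorem exists_fiber_gap {X : Type*} [MetricSpace X] {W V : Set (X × unitInterval)}
    (hW : IsCompact W) (hV : IsClosed V) (hd : Disjoint W V) :
    ∃ η > (0 : ℝ), ∀ x s s', (x, s) ∈ W → (x, s') ∈ V → η ≤ |(s : ℝ) - s'| := by
  obtain ⟨δ, hδ, h⟩ := hd.exists_thickenings hW hV
  refine ⟨δ, hδ, fun x s s' hs hs' => ?_⟩
  by_contra! hlt
  refine disjoint_left.1 h (Metric.self_subset_thickening hδ _ hs) ?_
  rw [Metric.mem_thickening_iff]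
  refine ⟨_, hs', ?_⟩
  rw [Prod.dist_eq, dist_self, max_eq_right dist_nonneg, Subtype.dist_eq, Real.dist_eq]
  exact hlt

/-- The data of a pair of disjoint continua with equal projections, each of which is below the
other at some point. -/
structure CrossedPair {X : Type*} [TopologicalSpace X]
    (P : Set (X × unitInterval) × Set (X × unitInterval)) : Prop where
  compact_fst : IsCompact P.1
  connected_fst : IsConnected P.1
  compact_snd : IsCompact P.2
  connected_snd : IsConnected P.2
  disj : Disjoint P.1 P.2
  image_eq : Prod.fst '' P.1 = Prod.fst '' P.2
  lt_fst : FiberLT P.1 P.2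
  lt_snd : FiberLT P.2 P.1

theorem CrossedPair.swap {X : Type*} [TopologicalSpace X]
    {P : Set (X × unitInterval) × Set (X × unitInterval)} (h : CrossedPair P) :
    CrossedPair P.swap :=
  ⟨h.3, h.4, h.1, h.2, h.5.symm, h.6.symm, h.8, h.7⟩

theorem CrossedPair.iInter {X ι : Type*} [TopologicalSpace X] [T2Space X] [CompactSpace X]
    [Nonempty ι] {P : ι → Set (X × unitInterval) × Set (X × unitInterval)}
    (hd : Directed (· ≥ ·) P) (h : ∀ i, CrossedPair (P i)) :
    CrossedPair (⋂ i, (P i).1, ⋂ i, (P i).2) := by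
  have hd1 : Directed (· ⊇ ·) fun i => (P i).1 := fun i j =>
    let ⟨k, hi, hj⟩ := hd i j
    ⟨k, hi.1, hj.1⟩
  have hd2 : Directed (· ⊇ ·) fun i => (P i).2 := fun i j =>
    let ⟨k, hi, hj⟩ := hd i j
    ⟨k, hi.2, hj.2⟩
  have c1 := fun i => (h i).compact_fst
  have c2 := fun i => (h i).compact_snd
  refine ⟨(isClosed_iInter fun i => (c1 i).isClosed).isCompact, ⟨?_, ?_⟩,
    (isClosed_iInter fun i => (c2 i).isClosed).isCompact, ⟨?_, ?_⟩, ?_, ?_, ?_, ?_⟩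
  · exact IsCompact.nonempty_iInter_of_directed_nonempty_isCompact_isClosed _ hd1
      (fun i => (h i).connected_fst.nonempty) c1 fun i => (c1 i).isClosed
  · exact IsPreconnected.iInter_of_directed hd1 c1 fun i => (h i).connected_fst.isPreconnected
  · exact IsCompact.nonempty_iInter_of_directed_nonempty_isCompact_isClosed _ hd2
      (fun i => (h i).connected_snd.nonempty) c2 fun i => (c2 i).isClosed
  · exact IsPreconnected.iInter_of_directed hd2 c2 fun i => (h i).connected_snd.isPreconnected
  · exact (h (Classical.arbitrary ι)).disj.mono (iInter_subset _ _) (iInter_subset _ _)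
  · simp only
    rw [image_iInter_of_directed_of_isCompact continuous_fst hd1 c1,
      image_iInter_of_directed_of_isCompact continuous_fst hd2 c2]
    exact iInter_congr fun i => (h i).image_eq
  · refine FiberLT.iInter (fun i j => ?_) (fun i => (c1 i).isClosed) (fun i => (c2 i).isClosed)
      (fun i => (h i).disj) fun i => (h i).lt_fst
    obtain ⟨k, hi, hj⟩ := hd i j
    exact ⟨k, hi.1, hj.1, hi.2, hj.2⟩
  · refine FiberLT.iInter (fun i j => ?_) (fun i => (c2 i).isClosed) (fun i => (c1 i).isClosed)
      (fun i => (h i).disj.symm) fun i => (h i).lt_snd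
    obtain ⟨k, hi, hj⟩ := hd i j
    exact ⟨k, hi.2, hj.2, hi.1, hj.1⟩

theorem CrossedPair.exists_minimal {X : Type*} [TopologicalSpace X] [T2Space X] [CompactSpace X]
    {P : Set (X × unitInterval) × Set (X × unitInterval)} (hP : CrossedPair P) :
    ∃ Q : Set (X × unitInterval) × Set (X × unitInterval),
      CrossedPair Q ∧ ∀ R, CrossedPair R → R ≤ Q → R = Q := by
  obtain ⟨m, -, hm, hmax⟩ := zorn_le_nonempty₀
    (α := (Set (X × unitInterval) × Set (X × unitInterval))ᵒᵈ)
    {p | CrossedPair (OrderDual.ofDual p)} (fun c hc hchain y hy => by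
      have : Nonempty c := ⟨⟨y, hy⟩⟩
      refine ⟨OrderDual.toDual (⋂ i : c, (OrderDual.ofDual i.1).1,
        ⋂ i : c, (OrderDual.ofDual i.1).2), ?_, ?_⟩
      · refine CrossedPair.iInter (P := fun i : c => OrderDual.ofDual i.1) ?_ fun i => hc i.2
        intro i j
        rcases hchain.total i.2 j.2 with h | h
        · exact ⟨j, h, le_rfl⟩
        · exact ⟨i, le_rfl, h⟩
      · intro z hz
        exact ⟨iInter_subset (fun i : c => (OrderDual.ofDual i.1).1) ⟨z, hz⟩,
          iInter_subset (fun i : c => (OrderDual.ofDual i.1).2) ⟨z, hz⟩⟩)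
    (OrderDual.toDual P) hP
  exact ⟨OrderDual.ofDual m, hm, fun R hR hRm =>
    le_antisymm hRm (hmax (y := OrderDual.toDual R) hR hRm)⟩

theorem CrossedPair.false_of_minimal_of_max {X : Type*} [MetricSpace X] [CompactSpace X]
    (hX : HereditarilyIndecomposable X)
    {P : Set (X × unitInterval) × Set (X × unitInterval)} (hP : CrossedPair P)
    (hmin : ∀ R, CrossedPair R → R ≤ P → R = P) {m : X × unitInterval} (hm : m ∈ P.1)
    (hmax : ∀ p ∈ P.2, p.2 ≤ m.2) : False := by
  obtain ⟨C, C'⟩ := P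
  obtain ⟨η, hη, hgap⟩ := exists_fiber_gap hP.compact_fst hP.compact_snd.isClosed hP.disj
  obtain ⟨x, s, s', hss, hs, hs'⟩ := hP.lt_fst
  have hlt : ∀ x (s s' : unitInterval), (x, s) ∈ C → (x, s') ∈ C' → s ≤ s' →
      (s : ℝ) + η ≤ m.2 := by
    intro x s s' h h' hle
    have h1 := hgap x s s' h h'
    have h2 : (s' : ℝ) ≤ m.2 := hmax _ h'
    have h3 : (s : ℝ) ≤ s' := hle
    rw [abs_of_nonpos (by linarith)] at h1
    linarith
  set O : Set (X × unitInterval) := {p | (m.2 : ℝ) - η / 2 < p.2} with hOdef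
  have hO : IsOpen O := isOpen_lt (by fun_prop) (by fun_prop)
  have hmO : m ∈ O := by simp only [hOdef, mem_ofPred_eq]; linarith
  have hq : (x, s) ∈ C \ O := ⟨hs, fun h => by
    have := hlt x s s' hs hs' hss.le
    simp only [hOdef, mem_ofPred_eq] at h
    linarith⟩
  obtain ⟨z, hz, hzO⟩ := hP.connected_fst.connectedComponentIn_diff_inter_closure_nonempty
    hP.compact_fst hO hq ⟨m, hm, hmO⟩
  have hz2 : (m.2 : ℝ) - η / 2 ≤ z.2 := by
    have : closure O ⊆ {p | (m.2 : ℝ) - η / 2 ≤ p.2} :=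
      closure_minimal (fun p (hp : (m.2 : ℝ) - η / 2 < p.2) => hp.le)
        (isClosed_le (by fun_prop) (by fun_prop))
    exact this hzO
  set D := connectedComponentIn (C \ O) (x, s)
  have hDC : D ⊆ C \ O := connectedComponentIn_subset _ _
  have hDc : IsCompact D := (hP.compact_fst.diff hO).isCompact_connectedComponentIn _
  have hDn : IsConnected D := isConnected_connectedComponentIn_iff.2 hq
  have hxD : (x, s) ∈ D := mem_connectedComponentIn hq
  have himg : Prod.fst '' D ⊆ Prod.fst '' C' := by
    have := hP.image_eq
    simp only at this
    rw [← this]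
    exact image_mono (hDC.trans sdiff_subset)
  have hL := hDc.image continuous_fst
  have hq' : (x, s') ∈ C' ∩ Prod.fst ⁻¹' (Prod.fst '' D) := ⟨hs', (x, s), hxD, rfl⟩
  have hconf := hX.image_connectedComponentIn continuous_fst hP.compact_snd hP.connected_snd hL
    (hDn.image _ continuous_fst.continuousOn) himg hq'.1 hq'.2
  set D' := connectedComponentIn (C' ∩ Prod.fst ⁻¹' (Prod.fst '' D)) (x, s')
  have hDC' : D' ⊆ C' := (connectedComponentIn_subset _ _).trans inter_subset_left
  have hD'c : IsCompact D' := (hP.compact_snd.inter_right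
    (hL.isClosed.preimage continuous_fst)).isCompact_connectedComponentIn _
  have hD'n : IsConnected D' := isConnected_connectedComponentIn_iff.2 hq'
  obtain ⟨w, hw, hwz⟩ : z.1 ∈ Prod.fst '' D' := hconf ▸ ⟨z, hz, rfl⟩
  obtain ⟨z1, z2⟩ := z
  obtain ⟨w1, w2⟩ := w
  obtain rfl : w1 = z1 := hwz
  have hwlt : w2 < z2 := by
    by_contra! hle
    have := hlt w1 z2 w2 (hDC hz).1 (hDC' hw) hle
    simp only at hz2
    linarith
  have := hmin (D, D') ⟨hDc, hDn, hD'c, hD'n,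
    hP.disj.mono (hDC.trans sdiff_subset) hDC', hconf.symm,
    ⟨x, s, s', hss, hxD, mem_connectedComponentIn hq'⟩, ⟨w1, w2, z2, hwlt, hw, hz⟩⟩
    ⟨hDC.trans sdiff_subset, hDC'⟩
  have hDeq : D = C := congrArg Prod.fst this
  exact (hDC (hDeq ▸ hm)).2 hmO

theorem HereditarilyIndecomposable.not_crossedPair {X : Type*} [MetricSpace X] [CompactSpace X]
    (hX : HereditarilyIndecomposable X)
    (P : Set (X × unitInterval) × Set (X × unitInterval)) : ¬ CrossedPair P := by
  intro hP
  obtain ⟨Q, hQ, hmin⟩ := hP.exists_minimal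
  obtain ⟨m, hm, hmmax⟩ := hQ.compact_fst.exists_isMaxOn hQ.connected_fst.nonempty
    continuous_snd.continuousOn
  obtain ⟨n, hn, hnmax⟩ := hQ.compact_snd.exists_isMaxOn hQ.connected_snd.nonempty
    continuous_snd.continuousOn
  rcases le_total n.2 m.2 with h | h
  · exact hQ.false_of_minimal_of_max hX hmin hm fun p hp => (hnmax hp).trans h
  · refine hQ.swap.false_of_minimal_of_max hX (fun R hR hRQ => ?_) hn
      fun p hp => (hmmax hp).trans h
    have := hmin R.swap hR.swap ⟨hRQ.2, hRQ.1⟩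
    rw [← this, Prod.swap_swap]

/-- A continuum reaching the top cannot lie below a disjoint continuum reaching the bottom. -/
theorem HereditarilyIndecomposable.not_lt_of_mem_top_of_mem_bot {X : Type*} [MetricSpace X]
    [CompactSpace X] (hX : HereditarilyIndecomposable X) {C C' : Set (X × unitInterval)}
    (hC : IsCompact C) (hCc : IsConnected C) (hC' : IsCompact C') (hCc' : IsConnected C')
    (hd : Disjoint C C') {x y z : X} {s s' : unitInterval} (hs : (x, s) ∈ C) (hs' : (x, s') ∈ C')
    (htop : (y, 1) ∈ C) (hbot : (z, 0) ∈ C') : ¬ s < s' := by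
  intro hlt
  have hA := hC.image continuous_fst
  have hB := hC'.image continuous_fst
  rcases hX.subset_or_subset hA (hCc.image _ continuous_fst.continuousOn) hB
    (hCc'.image _ continuous_fst.continuousOn) ⟨x, ⟨_, hs, rfl⟩, ⟨_, hs', rfl⟩⟩ with h | h
  · have hq : (x, s') ∈ C' ∩ Prod.fst ⁻¹' (Prod.fst '' C) := ⟨hs', _, hs, rfl⟩
    have hconf := hX.image_connectedComponentIn continuous_fst hC' hCc' hA
      (hCc.image _ continuous_fst.continuousOn) h hq.1 hq.2
    set D := connectedComponentIn (C' ∩ Prod.fst ⁻¹' (Prod.fst '' C)) (x, s')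
    have hD : D ⊆ C' := (connectedComponentIn_subset _ _).trans inter_subset_left
    obtain ⟨⟨w, r⟩, hw, rfl⟩ : y ∈ Prod.fst '' D := hconf ▸ ⟨_, htop, rfl⟩
    refine hX.not_crossedPair (C, D) ⟨hC, hCc,
      (hC'.inter_right (hA.isClosed.preimage continuous_fst)).isCompact_connectedComponentIn _,
      isConnected_connectedComponentIn_iff.2 hq, hd.mono_right hD, hconf.symm,
      ⟨x, s, s', hlt, hs, mem_connectedComponentIn hq⟩,
      ⟨w, r, 1, lt_of_le_of_ne unitInterval.le_one' ?_, hw, htop⟩⟩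
    rintro rfl
    exact disjoint_left.1 hd htop (hD hw)
  · have hq : (x, s) ∈ C ∩ Prod.fst ⁻¹' (Prod.fst '' C') := ⟨hs, _, hs', rfl⟩
    have hconf := hX.image_connectedComponentIn continuous_fst hC hCc hB
      (hCc'.image _ continuous_fst.continuousOn) h hq.1 hq.2
    set D := connectedComponentIn (C ∩ Prod.fst ⁻¹' (Prod.fst '' C')) (x, s)
    have hD : D ⊆ C := (connectedComponentIn_subset _ _).trans inter_subset_left
    obtain ⟨⟨w, r⟩, hw, rfl⟩ : z ∈ Prod.fst '' D := hconf ▸ ⟨_, hbot, rfl⟩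
    refine hX.not_crossedPair (D, C') ⟨
      (hC.inter_right (hB.isClosed.preimage continuous_fst)).isCompact_connectedComponentIn _,
      isConnected_connectedComponentIn_iff.2 hq, hC', hCc', hd.mono_left hD, hconf,
      ⟨x, s, s', hlt, mem_connectedComponentIn hq, hs'⟩,
      ⟨w, 0, r, lt_of_le_of_ne unitInterval.nonneg' ?_, hbot, hw⟩⟩
    rintro rfl
    exact disjoint_left.1 hd (hD hw) hbot

/-- `Γ` is a relatively clopen part of `W` containing `W ∩ S`. -/
structure IsClopenPart {Y : Type*} [TopologicalSpace Y] (W S Γ : Set Y) : Prop where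
  isClosed : IsClosed Γ
  subset : Γ ⊆ W
  isClosed_diff : IsClosed (W \ Γ)
  inter_subset : W ∩ S ⊆ Γ

theorem IsClopenPart.refl {Y : Type*} [TopologicalSpace Y] {W : Set Y} (hW : IsClosed W)
    (S : Set Y) : IsClopenPart W S W :=
  ⟨hW, Subset.rfl, by simp, inter_subset_left⟩

theorem IsClopenPart.inter {Y : Type*} [TopologicalSpace Y] {W S Γ Γ' : Set Y}
    (h : IsClopenPart W S Γ) (h' : IsClopenPart W S Γ') : IsClopenPart W S (Γ ∩ Γ') := by
  refine ⟨h.1.inter h'.1, inter_subset_left.trans h.2, ?_, subset_inter h.4 h'.4⟩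
  have : W \ (Γ ∩ Γ') = (W \ Γ) ∪ (W \ Γ') := by
    ext p; simp only [mem_sdiff, mem_inter_iff, mem_union]; tauto
  rw [this]
  exact h.3.union h'.3

theorem IsClopenPart.mem_of_isPreconnected {Y : Type*} [TopologicalSpace Y] {W S Γ T : Set Y}
    (h : IsClopenPart W S Γ) (hT : IsPreconnected T) (hTW : T ⊆ W) {p q : Y} (hp : p ∈ T)
    (hq : q ∈ T) (hpΓ : p ∈ Γ) : q ∈ Γ := by
  by_contra hqΓ
  obtain ⟨x, -, hx, hx'⟩ := isPreconnected_closed_iff.1 hT Γ (W \ Γ) h.1 h.3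
    (fun x hx => by
      by_cases hxΓ : x ∈ Γ
      · exact Or.inl hxΓ
      · exact Or.inr ⟨hTW hx, hxΓ⟩) ⟨p, hp, hpΓ⟩ ⟨q, hq, hTW hq, hqΓ⟩
  exact hx'.2 hx

theorem IsCompact.exists_isClopenPart_notMem {Y : Type*} [TopologicalSpace Y] [T2Space Y]
    {W S : Set Y} (hW : IsCompact W) (hS : IsClosed S) {p : Y} (hp : p ∈ W)
    (h : Disjoint (connectedComponentIn W p) S) : ∃ Γ, IsClopenPart W S Γ ∧ p ∉ Γ := by
  obtain ⟨F, F', hF, hF', hu, hd, hpF, hFS⟩ :=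
    hW.exists_split_of_disjoint_connectedComponentIn hS hp h
  refine ⟨F', ⟨hF'.isClosed, hu ▸ subset_union_right, ?_, ?_⟩, disjoint_left.1 hd hpF⟩
  · have : W \ F' = F := by
      rw [← hu, union_sdiff_right]
      exact hd.sdiff_eq_left
    rw [this]
    exact hF.isClosed
  · rintro x ⟨hx, hxS⟩
    rw [← hu] at hx
    exact hx.resolve_left fun hxF => disjoint_left.1 hFS hxF hxS

theorem HereditarilyIndecomposable.exists_isClopenPart {X : Type*} [MetricSpace X]
    [CompactSpace X] (hX : HereditarilyIndecomposable X) {W V : Set (X × unitInterval)}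
    (hW : IsClosed W) (hV : IsClosed V) (hd : Disjoint W V) :
    ∃ Γ Δ : Set (X × unitInterval), IsClopenPart W {p | p.2 = 1} Γ ∧
      IsClopenPart V {p | p.2 = 0} Δ ∧ ∀ x s s', s < s' → (x, s) ∈ Γ → (x, s') ∉ Δ := by
  have key := (isClosed_setOf_fiber_le hW hV).isCompact.induction_on
    (p := fun T => ∃ Γ Δ : Set (X × unitInterval), IsClopenPart W {p | p.2 = 1} Γ ∧
      IsClopenPart V {p | p.2 = 0} Δ ∧
      ∀ p ∈ T, (p.1, p.2.1) ∈ Γ → (p.1, p.2.2) ∉ Δ) ?_ ?_ ?_ ?_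
  · obtain ⟨Γ, Δ, hΓ, hΔ, h⟩ := key
    exact ⟨Γ, Δ, hΓ, hΔ, fun x s s' hs h1 h2 =>
      h (x, s, s') ⟨hΓ.subset h1, hΔ.subset h2, hs.le⟩ h1 h2⟩
  · exact ⟨W, V, .refl hW _, .refl hV _, fun p hp => absurd hp (notMem_empty p)⟩
  · rintro T T' hT ⟨Γ, Δ, hΓ, hΔ, h⟩
    exact ⟨Γ, Δ, hΓ, hΔ, fun p hp => h p (hT hp)⟩
  · rintro T T' ⟨Γ, Δ, hΓ, hΔ, h⟩ ⟨Γ', Δ', hΓ', hΔ', h'⟩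
    refine ⟨Γ ∩ Γ', Δ ∩ Δ', hΓ.inter hΓ', hΔ.inter hΔ', ?_⟩
    rintro p (hp | hp) h1 h2
    · exact h p hp h1.1 h2.1
    · exact h' p hp h1.2 h2.2
  · rintro ⟨x, s, s'⟩ ⟨hs, hs', hle⟩
    simp only at hs hs' hle
    have hlt : s < s' := lt_of_le_of_ne hle (by
      rintro rfl
      exact disjoint_left.1 hd hs hs')
    by_cases hW1 : Disjoint (connectedComponentIn W (x, s)) {p | p.2 = 1}
    · obtain ⟨Γ, hΓ, hn⟩ := hW.isCompact.exists_isClopenPart_notMem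
        (isClosed_eq continuous_snd continuous_const) hs hW1
      refine ⟨{p | (p.1, p.2.1) ∉ Γ}, mem_nhdsWithin_of_mem_nhds (IsOpen.mem_nhds ?_ hn), Γ, V, hΓ,
        .refl hV _, fun p hp h => absurd h hp⟩
      exact hΓ.isClosed.isOpen_compl.preimage (by fun_prop)
    by_cases hV0 : Disjoint (connectedComponentIn V (x, s')) {p | p.2 = 0}
    · obtain ⟨Δ, hΔ, hn⟩ := hV.isCompact.exists_isClopenPart_notMem
        (isClosed_eq continuous_snd continuous_const) hs' hV0
      refine ⟨{p | (p.1, p.2.2) ∉ Δ}, mem_nhdsWithin_of_mem_nhds (IsOpen.mem_nhds ?_ hn), W, Δ,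
        .refl hW _, hΔ, fun p hp _ => hp⟩
      exact hΔ.isClosed.isOpen_compl.preimage (by fun_prop)
    obtain ⟨⟨y, a⟩, hy, ha⟩ := not_disjoint_iff.1 hW1
    obtain ⟨⟨z, b⟩, hz, hb⟩ := not_disjoint_iff.1 hV0
    obtain rfl : a = 1 := ha
    obtain rfl : b = 0 := hb
    exact absurd hlt (hX.not_lt_of_mem_top_of_mem_bot
      (hW.isCompact.isCompact_connectedComponentIn _) (isConnected_connectedComponentIn_iff.2 hs)
      (hV.isCompact.isCompact_connectedComponentIn _) (isConnected_connectedComponentIn_iff.2 hs')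
      (hd.mono (connectedComponentIn_subset _ _) (connectedComponentIn_subset _ _))
      (mem_connectedComponentIn hs) (mem_connectedComponentIn hs') hy hz)

/-- The union of the vertical segments with endpoints in `Z` which avoid `E`. -/
def fiberHull {X : Type*} (Z E : Set (X × unitInterval)) : Set (X × unitInterval) :=
  {p | ∃ a c, a ≤ p.2 ∧ p.2 ≤ c ∧ (p.1, a) ∈ Z ∧ (p.1, c) ∈ Z ∧
    ∀ r, a ≤ r → r ≤ c → (p.1, r) ∉ E}

theorem isClosed_fiberHull {X : Type*} [TopologicalSpace X] [T2Space X] [CompactSpace X]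
    {Z E : Set (X × unitInterval)} (hZ : IsClosed Z) (hE : IsOpen E) :
    IsClosed (fiberHull Z E) := by
  have hcl : IsClosed {q : (X × unitInterval) × unitInterval × unitInterval |
      q.2.1 ≤ q.1.2 ∧ q.1.2 ≤ q.2.2 ∧ (q.1.1, q.2.1) ∈ Z ∧ (q.1.1, q.2.2) ∈ Z ∧
        ∀ r : unitInterval, (q.1.1, max q.2.1 (min r q.2.2)) ∈ Eᶜ} := by
    have h : IsClosed {q : (X × unitInterval) × unitInterval × unitInterval |
        ∀ r : unitInterval, (q.1.1, max q.2.1 (min r q.2.2)) ∈ Eᶜ} := by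
      rw [ofPred_forall]
      exact isClosed_iInter fun r => hE.isClosed_compl.preimage (by fun_prop)
    exact (isClosed_le (by fun_prop) (by fun_prop)).inter
      ((isClosed_le (by fun_prop) (by fun_prop)).inter
      ((hZ.preimage (by fun_prop)).inter ((hZ.preimage (by fun_prop)).inter h)))
  have : fiberHull Z E = Prod.fst '' {q : (X × unitInterval) × unitInterval × unitInterval |
      q.2.1 ≤ q.1.2 ∧ q.1.2 ≤ q.2.2 ∧ (q.1.1, q.2.1) ∈ Z ∧ (q.1.1, q.2.2) ∈ Z ∧
        ∀ r : unitInterval, (q.1.1, max q.2.1 (min r q.2.2)) ∈ Eᶜ} := by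
    ext p
    constructor
    · rintro ⟨a, c, ha, hc, haZ, hcZ, h⟩
      exact ⟨(p, a, c), ⟨ha, hc, haZ, hcZ, fun r => h _ (le_max_left _ _)
        (max_le (ha.trans hc) (min_le_right _ _))⟩, rfl⟩
    · rintro ⟨⟨p, a, c⟩, ⟨ha, hc, haZ, hcZ, h⟩, rfl⟩
      refine ⟨a, c, ha, hc, haZ, hcZ, fun r har hrc => ?_⟩
      have := h r
      simp only [min_eq_left hrc, max_eq_right har] at this
      exact this
  rw [this]
  exact (hcl.isCompact.image continuous_fst).isClosed

theorem subset_fiberHull {X : Type*} {Z E : Set (X × unitInterval)} (h : Disjoint Z E) :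
    Z ⊆ fiberHull Z E := fun p hp =>
  ⟨p.2, p.2, le_rfl, le_rfl, hp, hp, fun r h1 h2 => by
    rw [le_antisymm h2 h1]
    exact disjoint_left.1 h hp⟩

theorem disjoint_fiberHull {X : Type*} {Z E Z' E' : Set (X × unitInterval)} (hZ : Z ⊆ E)
    (hZ' : Z' ⊆ E') : Disjoint (fiberHull Z E') (fiberHull Z' E) := by
  rw [disjoint_left]
  rintro ⟨x, s⟩ ⟨a, c, ha, hc, haZ, hcZ, h⟩ ⟨a', c', ha', hc', haZ', hcZ', h'⟩
  simp only at *
  have h1 : a < a' := lt_of_not_ge fun hle => h' a hle (ha.trans hc') (hZ haZ)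
  exact h a' h1.le (ha'.trans hc) (hZ' haZ')

theorem segment_subset_fiberHull {X : Type*} {Z E : Set (X × unitInterval)} {x : X}
    {s s' : unitInterval} (hs : (x, s) ∈ fiberHull Z E) (hs' : (x, s') ∈ fiberHull Z E)
    (h : ∀ r, s ≤ r → r ≤ s' → (x, r) ∉ E) : Prod.mk x '' Icc s s' ⊆ fiberHull Z E := by
  obtain ⟨a, c, ha, hc, haZ, hcZ, hac⟩ := hs
  obtain ⟨a', c', ha', hc', haZ', hcZ', hac'⟩ := hs'
  rintro _ ⟨t, ⟨hst, hts⟩, rfl⟩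
  refine ⟨a, c', ha.trans hst, hts.trans hc', haZ, hcZ', fun r h1 h2 => ?_⟩
  rcases le_total r s with h3 | h3
  · exact hac r h1 (h3.trans hc)
  rcases le_total r s' with h4 | h4
  · exact h r h3 h4
  · exact hac' r (ha'.trans h4) h2

/-- There is a chain `s₀ < ⋯ < sₙ = s` in the fiber of `x` alternating between `Z false` and
`Z true`, starting in `Z false`. -/
def AltChain {X : Type*} (Z : Bool → Set (X × unitInterval)) (x : X) : ℕ → unitInterval → Prop
  | 0, s => (x, s) ∈ Z false
  | n + 1, s => (x, s) ∈ Z (n + 1).bodd ∧ ∃ r < s, AltChain Z x n r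

theorem AltChain.mem {X : Type*} {Z : Bool → Set (X × unitInterval)} {x : X} {n : ℕ}
    {s : unitInterval} (h : AltChain Z x n s) : (x, s) ∈ Z n.bodd := by
  cases n with
  | zero => exact h
  | succ n => exact h.1

theorem AltChain.exists_bound {X : Type*} [MetricSpace X] [CompactSpace X]
    {Z : Bool → Set (X × unitInterval)} (hZ : ∀ b, IsClosed (Z b))
    (hd : Disjoint (Z false) (Z true)) : ∃ N, ∀ x k s, N ≤ k → ¬ AltChain Z x k s := by
  obtain ⟨η, hη, h⟩ := exists_fiber_gap (hZ false).isCompact (hZ true) hd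
  have key : ∀ x k s, AltChain Z x k s → k * η ≤ s := by
    intro x k
    induction k with
    | zero => intro s _; simpa using s.2.1
    | succ n ih =>
      rintro s ⟨hs, r, hrs, hr⟩
      have h1 := ih r hr
      have h2 := hr.mem
      have hlt : (r : ℝ) < s := hrs
      have h3 : η ≤ s - r := by
        rw [Nat.bodd_succ] at hs
        cases hn : n.bodd <;> rw [hn] at hs h2
        · have := h x r s h2 hs
          rw [abs_of_neg (by linarith)] at this
          linarith
        · have := h x s r hs h2
          rwa [abs_of_pos (by linarith)] at this
      push_cast
      linarith
  obtain ⟨N, hN⟩ := exists_nat_gt (1 / η)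
  refine ⟨N, fun x k s hk hc => ?_⟩
  have h1 := key x k s hc
  have h2 : (s : ℝ) ≤ 1 := s.2.2
  rw [div_lt_iff₀ hη] at hN
  have : (N : ℝ) ≤ k := by exact_mod_cast hk
  nlinarith

/-- Exchange the colours of the points of `Z` outside of `Γ`. -/
def recolor {X : Type*} (Z Γ : Bool → Set X) (b : Bool) : Set X := (Z b ∩ Γ b) ∪ (Z (!b) \ Γ (!b))

theorem mem_recolor_of_mem {X : Type*} {Z Γ : Bool → Set X} (hd : Disjoint (Z false) (Z true))
    {b c : Bool} {p : X} (hp : p ∈ recolor Z Γ b) (hc : p ∈ Z c) : (p ∈ Γ c ↔ c = b) := by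
  have : p ∈ Z false → p ∉ Z true := fun h => disjoint_left.1 hd h
  cases b <;> cases c <;> simp [recolor] at hp ⊢ <;> tauto

theorem exists_mem_of_mem_recolor {X : Type*} {Z Γ : Bool → Set X} {b : Bool} {p : X}
    (hp : p ∈ recolor Z Γ b) : ∃ c, p ∈ Z c := by
  rcases hp with h | h
  · exact ⟨_, h.1⟩
  · exact ⟨_, h.1⟩

theorem exists_mem_recolor_of_mem {X : Type*} {Z Γ : Bool → Set X} {c : Bool} {p : X}
    (hp : p ∈ Z c) : ∃ b, p ∈ recolor Z Γ b := by
  by_cases h : p ∈ Γ c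
  · exact ⟨c, Or.inl ⟨hp, h⟩⟩
  · exact ⟨!c, Or.inr (by rw [Bool.not_not]; exact ⟨hp, h⟩)⟩

theorem disjoint_recolor {X : Type*} {Z Γ : Bool → Set X} (hd : Disjoint (Z false) (Z true)) :
    Disjoint (recolor Z Γ false) (recolor Z Γ true) := by
  rw [disjoint_left]
  intro p h h'
  obtain ⟨c, hc⟩ := exists_mem_of_mem_recolor h
  have h1 := mem_recolor_of_mem hd h hc
  have h2 := mem_recolor_of_mem hd h' hc
  rw [h1] at h2
  cases c <;> simp at h2

theorem AltChain.of_recolor {X : Type*} [TopologicalSpace X]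
    {Z₀ Z Γ : Bool → Set (X × unitInterval)} (hZ : ∀ b, Z b ⊆ interior (Z₀ b))
    (hd : Disjoint (Z₀ false) (Z₀ true)) (hbot : ∀ x, (x, 0) ∈ Z false)
    (hseg : ∀ b x s s', s < s' → (x, s) ∈ Z b → (x, s') ∈ Z b →
      (∀ r, s ≤ r → r ≤ s' → (x, r) ∉ interior (Z₀ !b)) → ((x, s) ∈ Γ b ↔ (x, s') ∈ Γ b))
    (hlt : ∀ x s s', s < s' → (x, s) ∈ Γ true → (x, s') ∉ Γ false) (x : X) (i : ℕ)
    (s : unitInterval) (h : AltChain (recolor Z Γ) x i s) :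
    (∃ k > i, AltChain Z₀ x k s ∧ (x, s) ∈ Z k.bodd) ∨
      (i ≤ 1 ∧ AltChain Z₀ x i s ∧ (x, s) ∈ Z i.bodd ∧ (x, s) ∈ Γ i.bodd) := by
  have hZ0 : ∀ b, Z b ⊆ Z₀ b := fun b => (hZ b).trans interior_subset
  have hdZ : Disjoint (Z false) (Z true) := hd.mono (hZ0 _) (hZ0 _)
  have hne : ∀ b p, p ∈ Z₀ b → p ∉ Z₀ !b := by
    intro b p hp hp'
    cases b
    · exact disjoint_left.1 hd hp hp'
    · exact disjoint_left.1 hd hp' hp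
  have append : ∀ k r s, r < s → AltChain Z₀ x k r → (x, r) ∈ Z k.bodd → (x, s) ∈ Z k.bodd →
      ¬ ((x, r) ∈ Γ k.bodd ↔ (x, s) ∈ Γ k.bodd) → AltChain Z₀ x (k + 2) s := by
    intro k r s hrs hr hrZ hsZ hΓ
    have : ∃ v, r ≤ v ∧ v ≤ s ∧ (x, v) ∈ interior (Z₀ !k.bodd) := by
      by_contra! hcon
      exact hΓ (hseg _ x r s hrs hrZ hsZ hcon)
    obtain ⟨v, hrv, hvs, hv⟩ := this
    have hv' := interior_subset hv
    have hrv' : r < v := lt_of_le_of_ne hrv (by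
      rintro rfl
      exact hne _ _ (hZ0 _ hrZ) hv')
    have hvs' : v < s := lt_of_le_of_ne hvs (by
      rintro rfl
      exact hne _ _ (hZ0 _ hsZ) hv')
    refine ⟨?_, v, hvs', ?_, r, hrv', hr⟩
    · rw [Nat.bodd_succ, Nat.bodd_succ, Bool.not_not]
      exact hZ0 _ hsZ
    · rw [Nat.bodd_succ]
      exact hv'
  induction i generalizing s with
  | zero =>
    rcases h with h | h
    · exact Or.inr ⟨zero_le_one, hZ0 _ h.1, h⟩
    · refine Or.inl ⟨1, zero_lt_one, ⟨hZ0 _ h.1, 0, ?_, hZ0 _ (hbot x)⟩, h.1⟩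
      refine lt_of_le_of_ne unitInterval.nonneg' ?_
      rintro rfl
      exact disjoint_left.1 hdZ (hbot x) h.1
  | succ i ih =>
    obtain ⟨hs, r, hrs, hr⟩ := h
    obtain ⟨c, hc⟩ := exists_mem_of_mem_recolor hs
    have hsΓ := mem_recolor_of_mem hdZ hs hc
    rcases ih r hr with ⟨k, hk, hkr, hrZ⟩ | ⟨hi, hir, hrZ, hrΓ⟩
    · have hrΓ := mem_recolor_of_mem hdZ hr.mem hrZ
      by_cases hck : c = k.bodd
      · subst hck
        refine Or.inl ⟨k + 2, by omega, append k r s hrs hkr hrZ hc ?_, ?_⟩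
        · rw [hrΓ, hsΓ, Nat.bodd_succ]
          generalize k.bodd = a
          generalize i.bodd = b
          revert a b
          decide
        · rw [Nat.bodd_succ, Nat.bodd_succ, Bool.not_not]
          exact hc
      · have hck' : c = (k + 1).bodd := by
          rw [Nat.bodd_succ]
          exact Bool.eq_not.2 hck
        subst hck'
        exact Or.inl ⟨k + 1, by omega, ⟨hZ0 _ hc, r, hrs, hkr⟩, hc⟩
    · by_cases hci : c = i.bodd
      · subst hci
        refine Or.inl ⟨i + 2, by omega, append i r s hrs hir hrZ hc ?_, ?_⟩
        · rw [hsΓ, Nat.bodd_succ]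
          intro h
          have := h.1 hrΓ
          simp at this
        · rw [Nat.bodd_succ, Nat.bodd_succ, Bool.not_not]
          exact hc
      · have hci' : c = (i + 1).bodd := by
          rw [Nat.bodd_succ]
          exact Bool.eq_not.2 hci
        subst hci'
        have hsΓ' := hsΓ.2 rfl
        obtain rfl | rfl : i = 0 ∨ i = 1 := by omega
        · exact Or.inr ⟨le_rfl, ⟨hZ0 _ hc, r, hrs, hir⟩, hc, hsΓ'⟩
        · exact absurd hsΓ' (hlt x r s hrs hrΓ)

theorem exists_continuous_notMem_of_not_altChain {X : Type*} [MetricSpace X] [CompactSpace X]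
    {Z : Bool → Set (X × unitInterval)} (hZ : ∀ b, IsClosed (Z b))
    (hd : Disjoint (Z false) (Z true)) (hbot : ∀ x, (x, 0) ∈ Z false)
    (htop : ∀ x, (x, 1) ∈ Z true) (hchain : ∀ x s, ¬ AltChain Z x 2 s) :
    ∃ t : X → unitInterval, Continuous t ∧ ∀ x b, (x, t x) ∉ Z b := by
  have hlt : ∀ x s s', (x, s) ∈ Z false → (x, s') ∈ Z true → s < s' := by
    intro x s s' hs hs'
    by_contra! hle
    have h1 : s' < s := lt_of_le_of_ne hle (by
      rintro rfl
      exact disjoint_left.1 hd hs hs')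
    have h0 : 0 < s' := lt_of_le_of_ne unitInterval.nonneg' (by
      rintro rfl
      exact disjoint_left.1 hd (hbot x) hs')
    exact hchain x s ⟨hs, s', h1, hs', 0, h0, hbot x⟩
  have hfib : ∀ x b, IsCompact {s | (x, s) ∈ Z b} := fun x b =>
    ((hZ b).preimage (by fun_prop)).isCompact
  have hproj : ∀ T : Set (X × unitInterval), IsClosed T → IsOpen (Prod.fst '' T)ᶜ := fun T hT =>
    (hT.isCompact.image continuous_fst).isClosed.isOpen_compl
  obtain ⟨g, hg⟩ := exists_continuous_forall_mem_convex_of_local_const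
    (t := fun x => {c : ℝ | (∀ s : unitInterval, (x, s) ∈ Z false → (s : ℝ) < c) ∧
      ∀ s : unitInterval, (x, s) ∈ Z true → c < s})
    (fun x a ha b hb u v hu hv huv => by
      refine ⟨fun s hs => ?_, fun s hs => ?_⟩
      · exact convex_Ioi (s : ℝ) (ha.1 s hs) (hb.1 s hs) hu hv huv
      · exact convex_Iio (s : ℝ) (ha.2 s hs) (hb.2 s hs) hu hv huv)
    (fun x => by
      obtain ⟨v, hv, hvmax⟩ := (hfib x false).exists_isMaxOn ⟨0, hbot x⟩ continuousOn_id
      obtain ⟨w, hw, hwmin⟩ := (hfib x true).exists_isMinOn ⟨1, htop x⟩ continuousOn_id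
      have hvw : (v : ℝ) < w := hlt x v w hv hw
      refine ⟨((v : ℝ) + w) / 2, ?_⟩
      have o1 := hproj (Z false ∩ {p | ((v : ℝ) + w) / 2 ≤ p.2})
        ((hZ _).inter (isClosed_le (by fun_prop) (by fun_prop)))
      have o2 := hproj (Z true ∩ {p | (p.2 : ℝ) ≤ ((v : ℝ) + w) / 2})
        ((hZ _).inter (isClosed_le (by fun_prop) (by fun_prop)))
      filter_upwards [o1.mem_nhds (x := x) (by
          rintro ⟨⟨_, s⟩, ⟨hs, hle⟩, rfl⟩
          have hsv : (s : ℝ) ≤ v := hvmax hs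
          have hle' : ((v : ℝ) + w) / 2 ≤ s := hle
          linarith), o2.mem_nhds (x := x) (by
          rintro ⟨⟨_, s⟩, ⟨hs, hle⟩, rfl⟩
          have hsv : (w : ℝ) ≤ s := hwmin hs
          have hle' : (s : ℝ) ≤ ((v : ℝ) + w) / 2 := hle
          linarith)] with y h1 h2
      refine ⟨fun s hs => ?_, fun s hs => ?_⟩
      · by_contra! hle
        exact h1 ⟨(y, s), ⟨hs, hle⟩, rfl⟩
      · by_contra! hle
        exact h2 ⟨(y, s), ⟨hs, hle⟩, rfl⟩)
  have hmem : ∀ x, g x ∈ unitInterval := fun x =>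
    ⟨((hg x).1 0 (hbot x)).le, ((hg x).2 1 (htop x)).le⟩
  refine ⟨fun x => ⟨g x, hmem x⟩, g.continuous.subtype_mk _, fun x b hx => ?_⟩
  cases b
  · exact lt_irrefl _ ((hg x).1 _ hx)
  · exact lt_irrefl _ ((hg x).2 _ hx)

theorem HereditarilyIndecomposable.exists_continuous_notMem_of_not_altChain {X : Type*}
    [MetricSpace X] [CompactSpace X] (hX : HereditarilyIndecomposable X) (n : ℕ) :
    ∀ {Z Z₀ : Bool → Set (X × unitInterval)}, (∀ b, IsClosed (Z b)) → (∀ b, IsClosed (Z₀ b)) →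
      (∀ b, Z b ⊆ interior (Z₀ b)) → Disjoint (Z₀ false) (Z₀ true) →
      (∀ x, (x, 0) ∈ Z false) → (∀ x, (x, 1) ∈ Z true) →
      (∀ x k s, n + 2 ≤ k → ¬ AltChain Z₀ x k s) →
      ∃ t : X → unitInterval, Continuous t ∧ ∀ x b, (x, t x) ∉ Z b := by
  induction n with
  | zero =>
    intro Z Z₀ _ hZ₀ hZZ hd hbot htop hchain
    have hsub : ∀ b, Z b ⊆ Z₀ b := fun b => (hZZ b).trans interior_subset
    obtain ⟨t, ht, h⟩ := _root_.exists_continuous_notMem_of_not_altChain hZ₀ hd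
      (fun x => hsub _ (hbot x)) (fun x => hsub _ (htop x)) fun x s => hchain x 2 s le_rfl
    exact ⟨t, ht, fun x b hx => h x b (hsub b hx)⟩
  | succ n ih =>
    intro Z Z₀ hZ hZ₀ hZZ hd hbot htop hchain
    choose O hO hZO hOZ using fun b => normal_exists_closure_subset (hZ b) isOpen_interior (hZZ b)
    set Y : Bool → Set (X × unitInterval) := fun b => closure (O b) with hYdef
    have hY : ∀ b, IsClosed (Y b) := fun b => isClosed_closure
    have hZY : ∀ b, Z b ⊆ interior (Y b) := fun b =>
      (hZO b).trans (interior_maximal subset_closure (hO b))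
    have hYZ₀ : ∀ b, Y b ⊆ interior (Z₀ b) := hOZ
    have hYsub : ∀ b, Y b ⊆ Z₀ b := fun b => (hYZ₀ b).trans interior_subset
    have hd' : ∀ b, Disjoint (Z₀ b) (Z₀ !b) := fun b => by
      cases b
      · exact hd
      · exact hd.symm
    have hdY : Disjoint (Y false) (Y true) := hd.mono (hYsub _) (hYsub _)
    set H : Bool → Set (X × unitInterval) := fun b => fiberHull (Y b) (interior (Z₀ !b))
    have hH : ∀ b, IsClosed (H b) := fun b => isClosed_fiberHull (hY b) isOpen_interior
    have hYH : ∀ b, Y b ⊆ H b := fun b =>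
      subset_fiberHull ((hd' b).mono (hYsub b) interior_subset)
    have hdH : Disjoint (H true) (H false) := disjoint_fiberHull (hYZ₀ true) (hYZ₀ false)
    obtain ⟨Γ₁, Γ₀, hΓ₁, hΓ₀, hlt⟩ := hX.exists_isClopenPart (hH true) (hH false) hdH
    set Γ : Bool → Set (X × unitInterval) := fun b => bif b then Γ₁ else Γ₀
    have hΓ : ∀ b, IsClopenPart (H b) {p | p.2 = bif b then 1 else 0} (Γ b) := by
      intro b
      cases b
      · exact hΓ₀
      · exact hΓ₁
    have hYbot : ∀ x, (x, 0) ∈ Y false := fun x => interior_subset (hZY _ (hbot x))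
    have hYtop : ∀ x, (x, 1) ∈ Y true := fun x => interior_subset (hZY _ (htop x))
    have hNbot : ∀ x, (x, 0) ∈ recolor Y Γ false := fun x =>
      Or.inl ⟨hYbot x, (hΓ false).inter_subset ⟨hYH _ (hYbot x), rfl⟩⟩
    have hNtop : ∀ x, (x, 1) ∈ recolor Y Γ true := fun x =>
      Or.inl ⟨hYtop x, (hΓ true).inter_subset ⟨hYH _ (hYtop x), rfl⟩⟩
    have hN : ∀ b, IsClosed (recolor Y Γ b) := by
      intro b
      refine ((hY b).inter (hΓ b).isClosed).union ?_
      have : Y (!b) \ Γ (!b) = Y (!b) ∩ (H (!b) \ Γ (!b)) := by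
        ext p
        exact ⟨fun h => ⟨h.1, hYH _ h.1, h.2⟩, fun h => ⟨h.1, h.2.2⟩⟩
      rw [this]
      exact (hY _).inter (hΓ _).isClosed_diff
    have hdN : Disjoint (recolor Y Γ false) (recolor Y Γ true) := disjoint_recolor hdY
    have hdN' : ∀ b, Disjoint (recolor Y Γ b) (recolor Y Γ !b) := fun b => by
      cases b
      · exact hdN
      · exact hdN.symm
    have hseg : ∀ b x s s', s < s' → (x, s) ∈ Y b → (x, s') ∈ Y b →
        (∀ r, s ≤ r → r ≤ s' → (x, r) ∉ interior (Z₀ !b)) →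
        ((x, s) ∈ Γ b ↔ (x, s') ∈ Γ b) := by
      intro b x s s' hss hs hs' h
      have hsub := segment_subset_fiberHull (hYH b hs) (hYH b hs') h
      have hpre : IsPreconnected (Prod.mk x '' Icc s s') :=
        isPreconnected_Icc.image _ (by fun_prop)
      have m1 : (x, s) ∈ Prod.mk x '' Icc s s' := ⟨s, left_mem_Icc.2 hss.le, rfl⟩
      have m2 : (x, s') ∈ Prod.mk x '' Icc s s' := ⟨s', right_mem_Icc.2 hss.le, rfl⟩
      exact ⟨(hΓ b).mem_of_isPreconnected hpre hsub m1 m2,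
        (hΓ b).mem_of_isPreconnected hpre hsub m2 m1⟩
    have hint : ∀ b, (Z false ∪ Z true) ∩ recolor Y Γ b ⊆ interior (recolor Y Γ b) := by
      rintro b p ⟨hp, hpN⟩
      have : ∃ c, p ∈ Z c := hp.elim (fun h => ⟨_, h⟩) fun h => ⟨_, h⟩
      obtain ⟨c, hc⟩ := this
      refine interior_maximal (t := interior (Y c) ∩ (recolor Y Γ !b)ᶜ) ?_
        (isOpen_interior.inter (hN _).isOpen_compl)
        ⟨hZY c hc, disjoint_left.1 (hdN' b) hpN⟩
      rintro q ⟨hq, hqN⟩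
      obtain ⟨e, he⟩ := exists_mem_recolor_of_mem (Γ := Γ) (interior_subset hq)
      by_cases heb : e = b
      · exact heb ▸ he
      · rw [Bool.eq_not.2 heb] at he
        exact absurd he hqN
    have hchain' : ∀ x k s, n + 2 ≤ k → ¬ AltChain (recolor Y Γ) x k s := by
      intro x k s hk hc
      rcases hc.of_recolor hYZ₀ hd hYbot hseg hlt with ⟨k', hk', hc', -⟩ | ⟨hk1, -⟩
      · exact hchain x k' s (by omega) hc'
      · omega
    obtain ⟨t, ht, h⟩ := ih (Z := fun b => (Z false ∪ Z true) ∩ recolor Y Γ b)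
      (Z₀ := recolor Y Γ) (fun b => ((hZ _).union (hZ _)).inter (hN b)) hN hint hdN
      (fun x => ⟨Or.inl (hbot x), hNbot x⟩) (fun x => ⟨Or.inr (htop x), hNtop x⟩) hchain'
    refine ⟨t, ht, fun x b hx => ?_⟩
    obtain ⟨c, hc⟩ := exists_mem_recolor_of_mem (Γ := Γ) (interior_subset (hZY b hx))
    refine h x c ⟨?_, hc⟩
    cases b
    · exact Or.inl hx
    · exact Or.inr hx

theorem HereditarilyIndecomposable.exists_continuous_notMem {X : Type*} [MetricSpace X]
    [CompactSpace X] (hX : HereditarilyIndecomposable X) {V W : Set (X × unitInterval)}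
    (hV : IsClosed V) (hW : IsClosed W) (hd : Disjoint V W) (hbot : ∀ x, (x, 0) ∈ V)
    (htop : ∀ x, (x, 1) ∈ W) :
    ∃ t : X → unitInterval, Continuous t ∧ ∀ x, (x, t x) ∉ V ∧ (x, t x) ∉ W := by
  obtain ⟨O, hO, hVO, hOW⟩ := normal_exists_closure_subset hV hW.isOpen_compl
    (subset_compl_iff_disjoint_right.2 hd)
  obtain ⟨P, hP, hWP, hPO⟩ := normal_exists_closure_subset hW isClosed_closure.isOpen_compl
    (subset_compl_comm.1 hOW)
  set Z₀ : Bool → Set (X × unitInterval) := fun b => bif b then closure P else closure O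
  have hZ₀ : ∀ b, IsClosed (Z₀ b) := fun b => by cases b <;> exact isClosed_closure
  have hd₀ : Disjoint (Z₀ false) (Z₀ true) := (subset_compl_iff_disjoint_right.1 hPO).symm
  obtain ⟨N, hN⟩ := AltChain.exists_bound hZ₀ hd₀
  obtain ⟨t, ht, h⟩ := hX.exists_continuous_notMem_of_not_altChain N
    (Z := fun b => bif b then W else V) (Z₀ := Z₀) (fun b => by cases b <;> assumption) hZ₀
    (fun b => by
      cases b
      · exact hVO.trans (interior_maximal subset_closure hO)
      · exact hWP.trans (interior_maximal subset_closure hP))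
    hd₀ hbot htop fun x k s hk => hN x k s (by omega)
  exact ⟨t, ht, fun x => ⟨h x false, h x true⟩⟩

theorem isGraphSpace_unitInterval : IsGraphSpace unitInterval :=
  ⟨1, fun _ => id, fun _ => ⟨continuous_id, Function.injective_id⟩,
    by simp only [range_id, iUnion_const],
    fun i j hij => absurd (Subsingleton.elim i j) hij⟩

theorem HereditarilyIndecomposable.exists_lift {X G : Type*} [MetricSpace X] [CompactSpace X]
    [TopologicalSpace G] [T1Space G] (hX : HereditarilyIndecomposable X)
    {f : X → G} (hf : Continuous f) {M U : Set (G × unitInterval)}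
    (hsep : SeparatesWithin univ M
      (univ ×ˢ ({0} : Set unitInterval)) (univ ×ˢ ({1} : Set unitInterval)))
    (hU : IsOpen U) (hMU : M ⊆ U) :
    ∃ t : X → unitInterval, Continuous t ∧ ∀ x, (f x, t x) ∈ U := by
  obtain ⟨A, B, hAB, hdAB, h0, h1, ⟨A', hA', rfl⟩, ⟨B', hB', rfl⟩⟩ := hsep
  have hφ : Continuous fun p : X × unitInterval => (f p.1, p.2) := by fun_prop
  have cover : ∀ p, p ∉ U → p ∈ A' ∨ p ∈ B' := fun p hp => by
    have : p ∈ univ \ M := ⟨trivial, fun h => hp (hMU h)⟩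
    rw [← hAB] at this
    exact this.imp And.right And.right
  have excl : ∀ p, p ∉ M → p ∈ A' → p ∉ B' := fun p hp ha hb =>
    (notMem_empty p) (hdAB ▸ ⟨⟨⟨trivial, hp⟩, ha⟩, ⟨⟨trivial, hp⟩, hb⟩⟩)
  have excl' : ∀ p, p ∉ U → p ∈ A' → p ∉ B' := fun p hp => excl p fun h => hp (hMU h)
  have hbot : ∀ g : G, (g, 0) ∉ M ∧ (g, 0) ∈ A' := fun g =>
    have h := h0 (mk_mem_prod (mem_univ g) (mem_singleton (0 : unitInterval)))
    ⟨h.1.2, h.2⟩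
  have htop : ∀ g : G, (g, 1) ∉ M ∧ (g, 1) ∈ B' := fun g =>
    have h := h1 (mk_mem_prod (mem_univ g) (mem_singleton (1 : unitInterval)))
    ⟨h.1.2, h.2⟩
  have hV : IsClosed ((Uᶜ ∩ B'ᶜ) ∪ {p : G × unitInterval | p.2 = 0}) :=
    (hU.isClosed_compl.inter hB'.isClosed_compl).union
      (isClosed_eq continuous_snd continuous_const)
  have hW : IsClosed ((Uᶜ ∩ A'ᶜ) ∪ {p : G × unitInterval | p.2 = 1}) :=
    (hU.isClosed_compl.inter hA'.isClosed_compl).union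
      (isClosed_eq continuous_snd continuous_const)
  have hd : Disjoint ((Uᶜ ∩ B'ᶜ) ∪ {p : G × unitInterval | p.2 = 0})
      ((Uᶜ ∩ A'ᶜ) ∪ {p : G × unitInterval | p.2 = 1}) := by
    rw [disjoint_left]
    rintro ⟨g, s⟩ (⟨hpU, hpB⟩ | hs) (⟨hpU', hpA⟩ | hs')
    · exact (cover _ hpU).elim hpA hpB
    · obtain rfl : s = 1 := hs'
      exact hpB (htop g).2
    · obtain rfl : s = 0 := hs
      exact hpA (hbot g).2
    · obtain rfl : s = 0 := hs
      exact zero_ne_one hs'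
  obtain ⟨t, ht, h⟩ := hX.exists_continuous_notMem (hV.preimage hφ) (hW.preimage hφ)
    (hd.preimage _) (fun x => Or.inr rfl) (fun x => Or.inr rfl)
  refine ⟨t, ht, fun x => ?_⟩
  by_contra hx
  rcases cover _ hx with ha | hb
  · exact (h x).1 (Or.inl ⟨hx, excl' _ hx ha⟩)
  · exact (h x).2 (Or.inl ⟨hx, fun ha => excl' _ hx ha hb⟩)

/-- A function on a decomposable continuum adapted to its decomposition. -/
theorem exists_continuous_le_half_ge_half {X : Type*} [MetricSpace X] {A B : Set X}
    (hA : IsClosed A) (hB : IsClosed B) {a b : X} (ha : a ∉ B) (hb : b ∉ A) (haA : a ∈ A)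
    (hbB : b ∈ B) :
    ∃ f : X → unitInterval, Continuous f ∧ (f a : ℝ) = 0 ∧ (f b : ℝ) = 1 ∧
      (∀ x ∈ A, (f x : ℝ) ≤ 1 / 2) ∧ ∀ x ∈ B, 1 / 2 ≤ (f x : ℝ) := by
  obtain ⟨g, hga, hgB, hg⟩ := exists_continuous_zero_one_of_isClosed
    (isClosed_singleton (x := a)) hB (disjoint_singleton_left.2 ha)
  obtain ⟨k, hkA, hkb, hk⟩ := exists_continuous_zero_one_of_isClosed hA
    (isClosed_singleton (x := b)) (disjoint_singleton_right.2 hb)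
  have ea : g a = 0 := hga rfl
  have eb : k b = 1 := hkb rfl
  have eB : ∀ x ∈ B, g x = 1 := fun x hx => hgB hx
  have eA : ∀ x ∈ A, k x = 0 := fun x hx => hkA hx
  refine ⟨fun x => ⟨(g x + k x) / 2, ?_, ?_⟩, by fun_prop, ?_, ?_, ?_, ?_⟩
  · linarith [(hg x).1, (hk x).1]
  · linarith [(hg x).2, (hk x).2]
  · simp [ea, eA a haA]
  · simp [eb, eB b hbB]
  · intro x hx
    simp only [eA x hx]
    linarith [(hg x).2]
  · intro x hx
    simp only [eB x hx]
    linarith [(hk x).1]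

theorem IsPreconnected.lt_of_forall_notMem_Icc {X : Type*} [TopologicalSpace X] {A : Set X}
    (hA : IsPreconnected A) {t : X → ℝ} (ht : Continuous t) {p q : ℝ} (hpq : p ≤ q)
    (h : ∀ x ∈ A, ¬ (p ≤ t x ∧ t x ≤ q)) {a c : X} (ha : a ∈ A) (hc : c ∈ A) (hap : t a < p) :
    t c < p := by
  by_contra! hle
  obtain ⟨x, hx, rfl⟩ := hA.intermediate_value ha hc ht.continuousOn ⟨hap.le, hle⟩
  exact h x hx ⟨le_rfl, hpq⟩

/-- characterization of hereditary indecomposability via maps into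
neighborhoods of separators in G × [0,1]. -/
theorem stmt15 (X : Type*) [MetricSpace X] [CompactSpace X] :
    HereditarilyIndecomposable X ↔
    ∀ (G : Type) [MetricSpace G] [CompactSpace G], IsGraphSpace G →
      ∀ f : X → G, Continuous f →
      ∀ M U : Set (G × unitInterval),
        (∀ p ∈ M, p.2 ≠ 0 ∧ p.2 ≠ 1) →
        SeparatesWithin Set.univ M
          (Set.univ ×ˢ ({0} : Set unitInterval)) (Set.univ ×ˢ ({1} : Set unitInterval)) →
        IsOpen U → M ⊆ U →
        ∀ ε > (0 : ℝ), ∃ h : X → G × unitInterval, Continuous h ∧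
          Set.range h ⊆ U ∧ ∀ x, dist (f x) (h x).1 < ε := by
  constructor
  · intro hX G _ _ _ f hf M U _ hsep hU hMU ε hε
    obtain ⟨t, ht, h⟩ := hX.exists_lift hf hsep hU hMU
    refine ⟨fun x => (f x, t x), hf.prodMk ht, ?_, fun x => by simpa using hε⟩
    rintro _ ⟨x, rfl⟩
    exact h x
  · rintro hG K hKc hK - ⟨A, B, hAc, hA, hBc, hB, hAB, hAK, hBK⟩
    obtain ⟨a, haA, haB⟩ : ∃ a ∈ A, a ∉ B := by
      by_contra! hcon
      exact hBK (by rw [← hAB, union_eq_right.2 hcon])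
    obtain ⟨b, hbB, hbA⟩ : ∃ b ∈ B, b ∉ A := by
      by_contra! hcon
      exact hAK (by rw [← hAB, union_eq_left.2 hcon])
    obtain ⟨c, -, hcA, hcB⟩ := isPreconnected_closed_iff.1 hK.isPreconnected A B hAc.isClosed
      hBc.isClosed hAB.ge ⟨a, hAB ▸ Or.inl haA, haA⟩ ⟨b, hAB ▸ Or.inr hbB, hbB⟩
    obtain ⟨f, hf, fa, fb, fA, fB⟩ :=
      exists_continuous_le_half_ge_half hAc.isClosed hBc.isClosed haB hbA haA hbB
    set V : Set (unitInterval × unitInterval) := {p | (p.2 : ℝ) = 0 ∨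
      (7 / 8 ≤ (p.1 : ℝ) ∧ (p.2 : ℝ) ≤ 5 / 7) ∨
      (3 / 8 ≤ (p.1 : ℝ) ∧ 4 / 7 ≤ (p.2 : ℝ) ∧ (p.2 : ℝ) ≤ 5 / 7)}
    set W : Set (unitInterval × unitInterval) := {p | (p.2 : ℝ) = 1 ∨
      ((p.1 : ℝ) ≤ 1 / 8 ∧ 2 / 7 ≤ (p.2 : ℝ)) ∨
      ((p.1 : ℝ) ≤ 5 / 8 ∧ 2 / 7 ≤ (p.2 : ℝ) ∧ (p.2 : ℝ) ≤ 3 / 7)}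
    have c1 : Continuous fun p : unitInterval × unitInterval => (p.1 : ℝ) := by fun_prop
    have c2 : Continuous fun p : unitInterval × unitInterval => (p.2 : ℝ) := by fun_prop
    have hV : IsClosed V := (isClosed_eq c2 continuous_const).union
      (((isClosed_le continuous_const c1).inter (isClosed_le c2 continuous_const)).union
      ((isClosed_le continuous_const c1).inter
      ((isClosed_le continuous_const c2).inter (isClosed_le c2 continuous_const))))
    have hW : IsClosed W := (isClosed_eq c2 continuous_const).union
      (((isClosed_le c1 continuous_const).inter (isClosed_le continuous_const c2)).union
      ((isClosed_le c1 continuous_const).inter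
      ((isClosed_le continuous_const c2).inter (isClosed_le c2 continuous_const))))
    have hd : Disjoint V W := by
      rw [disjoint_left]
      rintro p (h | ⟨h, h'⟩ | ⟨h, h', h''⟩) (k | ⟨k, k'⟩ | ⟨k, k', k''⟩) <;> linarith
    have hVW : univ \ (V ∪ W)ᶜ = V ∪ W := by rw [← compl_eq_univ_sdiff, compl_compl]
    have hU : IsOpen (V ∪ W)ᶜ := (hV.union hW).isOpen_compl
    obtain ⟨h, hh, hhU, hhf⟩ := hG unitInterval isGraphSpace_unitInterval f hf (V ∪ W)ᶜ (V ∪ W)ᶜ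
      (fun p hp => ⟨fun e => hp (Or.inl (Or.inl (by simp [e]))),
        fun e => hp (Or.inr (Or.inl (by simp [e])))⟩)
      ⟨V, W, hVW.symm, hd.inter_eq, fun p hp => Or.inl (by simp [show p.2 = 0 from hp.2]),
        fun p hp => Or.inl (by simp [show p.2 = 1 from hp.2]),
        ⟨Wᶜ, hW.isOpen_compl, by
          rw [hVW, ← sdiff_eq, union_sdiff_right, hd.sdiff_eq_left]⟩,
        ⟨Vᶜ, hV.isOpen_compl, by
          rw [hVW, ← sdiff_eq, union_sdiff_left, hd.sdiff_eq_right]⟩⟩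
      hU Subset.rfl (1 / 16) (by norm_num)
    have hclose : ∀ x, |(f x : ℝ) - (h x).1| < 1 / 16 := fun x => hhf x
    have hnV : ∀ x, h x ∉ V := fun x hx => hhU ⟨x, rfl⟩ (Or.inl hx)
    have hnW : ∀ x, h x ∉ W := fun x hx => hhU ⟨x, rfl⟩ (Or.inr hx)
    have ht : Continuous fun x => ((h x).2 : ℝ) := by fun_prop
    have hcA' : ((h c).2 : ℝ) < 2 / 7 := by
      refine hA.isPreconnected.lt_of_forall_notMem_Icc ht (q := 3 / 7) (by norm_num)
        (fun x hx hcon => ?_) haA hcA ?_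
      · refine hnW x (Or.inr (Or.inr ⟨?_, hcon⟩))
        have := abs_lt.1 (hclose x)
        linarith [fA x hx]
      · by_contra! hle
        refine hnW a (Or.inr (Or.inl ⟨?_, hle⟩))
        have := abs_lt.1 (hclose a)
        linarith
    have htn : Continuous fun x => -((h x).2 : ℝ) := ht.neg
    have hcB' : -((h c).2 : ℝ) < -(5 / 7) := by
      refine hB.isPreconnected.lt_of_forall_notMem_Icc htn (q := -(4 / 7)) (by norm_num)
        (fun x hx hcon => ?_) hbB hcB ?_
      · refine hnV x (Or.inr (Or.inr ⟨?_, ?_, ?_⟩))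
        · have := abs_lt.1 (hclose x)
          linarith [fB x hx]
        · linarith [hcon.2]
        · linarith [hcon.1]
      · by_contra! hle
        refine hnV b (Or.inr (Or.inl ⟨?_, by linarith⟩))
        have := abs_lt.1 (hclose b)
        linarith
    linarith
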